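/- Assume T(𝓛) acts transitively on 𝓛 and contains a 3-cycle. Then T(𝓛) contains the alternating group on 𝓛. -/

import Mathlib

open scoped symmDiff

namespace TogglePaper

variable {E : Type*} [DecidableEq E]

/-- The toggle `τ_e` on the collection `L` of subsets of the ground set. -/
def toggle (L : Finset (Finset E)) (e : E) : Equiv.Perm {A : Finset E // A ∈ L} :=
  Function.Involutive.toPerm
    (fun X => if h : X.1 ∆ ({e} : Finset E) ∈ L then ⟨X.1 ∆ ({e} : Finset E), h⟩ else X)
    (by
      intro X
      by_cases h : X.1 ∆ ({e} : Finset E) ∈ L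
      · have h2 : (X.1 ∆ ({e} : Finset E)) ∆ ({e} : Finset E) = X.1 :=
          symmDiff_symmDiff_cancel_right _ _
        simp only [dif_pos h, h2]
        simp [h2, X.2]
      · simp [h])

/-- The generalized toggle group `T(L)`. -/
def toggleGroup (L : Finset (Finset E)) : Subgroup (Equiv.Perm {A : Finset E // A ∈ L}) :=
  Subgroup.closure (Set.range (toggle L))

/-- `T(L)` acts transitively on `L`. -/
def IsTransitive (L : Finset (Finset E)) : Prop :=
  ∀ A B : {A : Finset E // A ∈ L}, ∃ g ∈ toggleGroup L, g A = B

/-- `B` is a block for the action of `T(L)` on `L`. -/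
def IsBlock (L : Finset (Finset E)) (B : Finset {A : Finset E // A ∈ L}) : Prop :=
  ∀ g ∈ toggleGroup L, Finset.image g B = B ∨ Disjoint (Finset.image g B) B

/-- `Blocks` is a block system for `T(L)`: a partition of `L` into nonempty blocks
that is permuted by every element of `T(L)`. -/
def IsBlockSystem (L : Finset (Finset E))
    (Blocks : Finset (Finset {A : Finset E // A ∈ L})) : Prop :=
  (∀ B ∈ Blocks, B.Nonempty) ∧
  (∀ A : {A : Finset E // A ∈ L}, ∃! B : Finset {A : Finset E // A ∈ L},
      B ∈ Blocks ∧ A ∈ B) ∧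
  (∀ g ∈ toggleGroup L, ∀ B ∈ Blocks, Finset.image g B ∈ Blocks)

/-- An element `g` of `T(L)` is type 2 (with respect to a fixed block system `Blocks`)
if it maps each block to itself; it is type 1 otherwise. -/
def IsType2 (L : Finset (Finset E)) (Blocks : Finset (Finset {A : Finset E // A ∈ L}))
    (g : Equiv.Perm {A : Finset E // A ∈ L}) : Prop :=
  ∀ B ∈ Blocks, Finset.image g B = B

/-- The action of `T(L)` on `L` is primitive: it is transitive and the only blocks
are the singletons, the empty set and the whole set. -/
def IsPrimitive (L : Finset (Finset E)) : Prop :=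
  IsTransitive L ∧
    ∀ B : Finset {A : Finset E // A ∈ L}, IsBlock L B → B.card ≤ 1 ∨ B = Finset.univ

/-- `T(L)` contains a long cycle, i.e. a cycle whose support is all of `L`. -/
def HasLongCycle (L : Finset (Finset E)) : Prop :=
  ∃ g ∈ toggleGroup L, g.IsCycle ∧ g.support = Finset.univ

section Toggle

variable {L : Finset (Finset E)}

theorem toggle_mem (e : E) : toggle L e ∈ toggleGroup L :=
  Subgroup.subset_closure ⟨e, rfl⟩

theorem toggle_toggle (e : E) (X : {A : Finset E // A ∈ L}) :
    toggle L e (toggle L e X) = X :=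
  Function.Involutive.toPerm_involutive _ X

theorem toggle_of_mem {e : E} {X : {A : Finset E // A ∈ L}} (h : X.1 ∆ {e} ∈ L) :
    toggle L e X = ⟨X.1 ∆ {e}, h⟩ :=
  dif_pos h

theorem toggle_val_of_ne {e : E} {X : {A : Finset E // A ∈ L}} (h : toggle L e X ≠ X) :
    (toggle L e X).1 = X.1 ∆ {e} := by
  by_cases hm : X.1 ∆ {e} ∈ L
  · rw [toggle_of_mem hm]
  · exact absurd (dif_neg hm) h

theorem mem_toggle_iff {e f : E} (hfe : f ≠ e) (X : {A : Finset E // A ∈ L}) :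
    f ∈ (toggle L e X).1 ↔ f ∈ X.1 := by
  by_cases h : toggle L e X = X
  · rw [h]
  · rw [toggle_val_of_ne h]
    simp [Finset.mem_symmDiff, hfe]

theorem symmDiff_singleton_ne (A : Finset E) (e : E) : A ∆ {e} ≠ A := by
  simp

/-- If `e` moves both `X` and `τ_f X`, and `f` moves `X`, then `f` moves `τ_e X`, and the two
toggles commute at `X`. -/
theorem toggle_square {e f : E} {X : {A : Finset E // A ∈ L}} (he : toggle L e X ≠ X)
    (hf : toggle L f X ≠ X) (hef : toggle L e (toggle L f X) ≠ toggle L f X) :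
    toggle L f (toggle L e X) = toggle L e (toggle L f X) ∧
      toggle L f (toggle L e X) ≠ toggle L e X := by
  have h1 := toggle_val_of_ne hef
  rw [toggle_val_of_ne hf, symmDiff_right_comm, ← toggle_val_of_ne he] at h1
  have hm : (toggle L e X).1 ∆ {f} ∈ L := h1 ▸ (toggle L e (toggle L f X)).2
  have h2 := toggle_of_mem hm
  refine ⟨h2.trans (Subtype.ext h1.symm), fun h => ?_⟩
  exact symmDiff_singleton_ne (toggle L e X).1 f (congrArg Subtype.val (h2.symm.trans h))

end Toggle

section Congruence

variable {L : Finset (Finset E)}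

/-- The equivalence relation `r` is preserved by the toggle group. -/
def IsCongruence (L : Finset (Finset E)) (r : Setoid {A : Finset E // A ∈ L}) : Prop :=
  ∀ g ∈ toggleGroup L, ∀ X Y, r X Y → r (g X) (g Y)

/-- The toggle at `e` moves some member of `L` inside its own class. -/
def IsInternal (L : Finset (Finset E)) (r : Setoid {A : Finset E // A ∈ L}) (e : E) : Prop :=
  ∃ X, toggle L e X ≠ X ∧ r X (toggle L e X)

variable {r : Setoid {A : Finset E // A ∈ L}}

theorem IsCongruence.toggle (hr : IsCongruence L r) (e : E) {X Y : {A : Finset E // A ∈ L}}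
    (h : r X Y) : r (toggle L e X) (toggle L e Y) :=
  hr _ (toggle_mem e) _ _ h

theorem IsCongruence.rel_toggle_of_rel (hr : IsCongruence L r) {e : E}
    {X Y : {A : Finset E // A ∈ L}} (h : r X Y) (hX : r X (TogglePaper.toggle L e X)) :
    r Y (TogglePaper.toggle L e Y) :=
  r.trans (r.symm h) (r.trans hX (hr.toggle e h))

theorem IsInternal.rel_toggle (hr : IsCongruence L r) (htrans : IsTransitive L) {f : E}
    (hf : IsInternal L r f) (X : {A : Finset E // A ∈ L}) : r X (toggle L f X) := by
  let P : {A : Finset E // A ∈ L} → Prop :=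
    fun X => ∃ Y, r X Y ∧ toggle L f Y ≠ Y ∧ r Y (toggle L f Y)
  have step : ∀ (e : E) (X), P X → P (toggle L e X) := by
    rintro e X ⟨Y, hXY, hne, hY⟩
    by_cases he : r X (toggle L e X)
    · exact ⟨Y, r.trans (r.symm he) hXY, hne, hY⟩
    · have moved : ∀ Z, r X Z → toggle L e Z ≠ Z := fun Z hZ h =>
        he (hr.rel_toggle_of_rel (r.symm hZ) (h.symm ▸ r.refl Z))
      obtain ⟨h1, h2⟩ := toggle_square (moved Y hXY) hne (moved _ (r.trans hXY hY))
      exact ⟨toggle L e Y, hr.toggle e hXY, h2, h1 ▸ hr.toggle e hY⟩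
  have key : ∀ g ∈ toggleGroup L, ∀ X, P X ↔ P (g X) := by
    intro g hg
    induction hg using Subgroup.closure_induction with
    | mem g hg =>
      obtain ⟨e, rfl⟩ := hg
      refine fun X => ⟨step e X, fun h => ?_⟩
      simpa [toggle_toggle] using step e _ h
    | one => simp
    | mul a b _ _ ha hb => exact fun X => (hb X).trans (ha (b X))
    | inv a _ ha => exact fun X => by simpa using (ha (a⁻¹ X)).symm
  obtain ⟨X₀, h1, h2⟩ := hf
  obtain ⟨g, hg, rfl⟩ := htrans X₀ X
  obtain ⟨Y, hXY, -, hY⟩ := (key g hg X₀).1 ⟨X₀, r.refl _, h1, h2⟩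
  exact hr.rel_toggle_of_rel (r.symm hXY) hY

theorem toggle_ne_of_rel (hr : IsCongruence L r) {e : E} (he : ¬ IsInternal L r e)
    {X Y : {A : Finset E // A ∈ L}} (h : r X Y) (hX : toggle L e X ≠ X) :
    toggle L e Y ≠ Y := fun hY =>
  he ⟨X, hX, hr.rel_toggle_of_rel (r.symm h) (hY.symm ▸ r.refl Y)⟩

theorem commute_toggle (hr : IsCongruence L r) (htrans : IsTransitive L) {e f : E}
    (he : ¬ IsInternal L r e) (hf : IsInternal L r f) :
    Commute (toggle L e) (toggle L f) := by
  have hrel := hf.rel_toggle hr htrans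
  ext1 X
  simp only [Equiv.Perm.mul_apply]
  have moved : ∀ X, toggle L e X ≠ X → toggle L f X ≠ X →
      toggle L f (toggle L e X) = toggle L e (toggle L f X) ∧
        toggle L f (toggle L e X) ≠ toggle L e X :=
    fun X h1 h2 => toggle_square h1 h2 (toggle_ne_of_rel hr he (hrel X) h1)
  by_cases h1 : toggle L e X = X
  · have h2 : toggle L e (toggle L f X) = toggle L f X := by
      by_contra h
      exact toggle_ne_of_rel hr he (r.symm (hrel X)) h h1
    rw [h1, h2]
  · by_cases h2 : toggle L f X = X
    · have h3 : toggle L f (toggle L e X) = toggle L e X := by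
        by_contra h
        have := (moved (toggle L e X) (by rw [toggle_toggle]; exact Ne.symm h1) h).2
        rw [toggle_toggle] at this
        exact this h2
      rw [h2, h3]
    · exact (moved X h1 h2).1.symm

variable (L r) in
/-- The group generated by the toggles that move members of `L` inside their class. -/
def internalGroup : Subgroup (Equiv.Perm {A : Finset E // A ∈ L}) :=
  Subgroup.closure (toggle L '' {e | IsInternal L r e})

variable (L r) in
/-- The group generated by the toggles that never move a member of `L` inside its class. -/
def externalGroup : Subgroup (Equiv.Perm {A : Finset E // A ∈ L}) :=
  Subgroup.closure (toggle L '' {e | ¬ IsInternal L r e})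

theorem externalGroup_le : externalGroup L r ≤ toggleGroup L :=
  Subgroup.closure_mono (Set.image_subset_range _ _)

theorem commute_external_internal (hr : IsCongruence L r) (htrans : IsTransitive L)
    {n m : Equiv.Perm {A : Finset E // A ∈ L}} (hn : n ∈ externalGroup L r)
    (hm : m ∈ internalGroup L r) : Commute n m := by
  have gen : ∀ e, ¬ IsInternal L r e → Commute (toggle L e) m := by
    intro e he
    induction hm using Subgroup.closure_induction with
    | mem m hm =>
      obtain ⟨f, hf, rfl⟩ := hm
      exact commute_toggle hr htrans he hf
    | one => exact Commute.one_right _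
    | mul a b _ _ ha hb => exact ha.mul_right hb
    | inv a _ ha => exact ha.inv_right
  induction hn using Subgroup.closure_induction with
  | mem n hn =>
    obtain ⟨e, he, rfl⟩ := hn
    exact gen e he
  | one => exact Commute.one_left _
  | mul a b _ _ ha hb => exact ha.mul_left hb
  | inv a _ ha => exact ha.inv_left

theorem exists_eq_external_mul_internal (hr : IsCongruence L r) (htrans : IsTransitive L)
    {g : Equiv.Perm {A : Finset E // A ∈ L}} (hg : g ∈ toggleGroup L) :
    ∃ n ∈ externalGroup L r, ∃ m ∈ internalGroup L r, g = n * m := by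
  induction hg using Subgroup.closure_induction with
  | mem g hg =>
    obtain ⟨e, rfl⟩ := hg
    by_cases he : IsInternal L r e
    · exact ⟨1, one_mem _, _, Subgroup.subset_closure ⟨e, he, rfl⟩, (one_mul _).symm⟩
    · exact ⟨_, Subgroup.subset_closure ⟨e, he, rfl⟩, 1, one_mem _, (mul_one _).symm⟩
  | one => exact ⟨1, one_mem _, 1, one_mem _, (one_mul _).symm⟩
  | mul a b _ _ ha hb =>
    obtain ⟨n, hn, m, hm, rfl⟩ := ha
    obtain ⟨n', hn', m', hm', rfl⟩ := hb
    exact ⟨n * n', mul_mem hn hn', m * m', mul_mem hm hm',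
      (commute_external_internal hr htrans hn' hm).symm.mul_mul_mul_comm n m'⟩
  | inv a _ ha =>
    obtain ⟨n, hn, m, hm, rfl⟩ := ha
    exact ⟨n⁻¹, inv_mem hn, m⁻¹, inv_mem hm, by
      rw [(commute_external_internal hr htrans hn hm).eq, mul_inv_rev]⟩

theorem mem_iff_of_mem_closure_toggle {S : Set E} {g : Equiv.Perm {A : Finset E // A ∈ L}}
    (hg : g ∈ Subgroup.closure (toggle L '' S)) {e : E} (he : e ∉ S)
    (X : {A : Finset E // A ∈ L}) : e ∈ (g X).1 ↔ e ∈ X.1 := by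
  induction hg using Subgroup.closure_induction generalizing X with
  | mem g hg =>
    obtain ⟨f, hf, rfl⟩ := hg
    exact mem_toggle_iff (by rintro rfl; exact he hf) X
  | one => rfl
  | mul a b _ _ ha hb => exact (ha (b X)).trans (hb X)
  | inv a _ ha => simpa using (ha (a⁻¹ X)).symm

theorem rel_internal_apply (hr : IsCongruence L r) (htrans : IsTransitive L)
    {m : Equiv.Perm {A : Finset E // A ∈ L}} (hm : m ∈ internalGroup L r)
    (X : {A : Finset E // A ∈ L}) : r X (m X) := by
  induction hm using Subgroup.closure_induction generalizing X with
  | mem m hm =>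
    obtain ⟨f, hf, rfl⟩ := hm
    exact hf.rel_toggle hr htrans X
  | one => exact r.refl X
  | mul a b _ _ ha hb => exact r.trans (hb X) (ha (b X))
  | inv a _ ha => simpa using r.symm (ha (a⁻¹ X))

/-- Elements of the external group translate each class by a fixed set. -/
theorem external_symmDiff_eq (hr : IsCongruence L r)
    {n : Equiv.Perm {A : Finset E // A ∈ L}} (hn : n ∈ externalGroup L r)
    {X Y : {A : Finset E // A ∈ L}} (h : r X Y) :
    (n X).1 ∆ X.1 = (n Y).1 ∆ Y.1 := by
  induction hn using Subgroup.closure_induction generalizing X Y with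
  | mem n hn =>
    obtain ⟨e, he, rfl⟩ := hn
    by_cases hX : toggle L e X = X
    · have hY : toggle L e Y = Y := by
        by_contra hY
        exact toggle_ne_of_rel hr he (r.symm h) hY hX
      rw [hX, hY, symmDiff_self, symmDiff_self]
    · rw [toggle_val_of_ne hX, toggle_val_of_ne (toggle_ne_of_rel hr he h hX),
        symmDiff_symmDiff_self', symmDiff_symmDiff_self']
  | one => simp
  | mul a b _ hb iha ihb =>
    have h1 := ihb h
    have h2 := iha (hr b (externalGroup_le hb) _ _ h)
    rw [Equiv.Perm.mul_apply, Equiv.Perm.mul_apply,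
      ← symmDiff_symmDiff_cancel_right (b X).1 (a (b X)).1, h2, symmDiff_assoc, h1,
      ← symmDiff_assoc, symmDiff_symmDiff_cancel_right]
  | inv a ha iha =>
    have h1 := iha (hr a⁻¹ (inv_mem (externalGroup_le ha)) _ _ h)
    rw [← Equiv.Perm.mul_apply, ← Equiv.Perm.mul_apply, mul_inv_cancel, Equiv.Perm.one_apply,
      Equiv.Perm.one_apply] at h1
    rw [symmDiff_comm, h1, symmDiff_comm]

theorem exists_toggle_not_rel (hr : IsCongruence L r) (htrans : IsTransitive L)
    (hnontriv : ∃ X Y, ¬ r X Y) (X : {A : Finset E // A ∈ L}) :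
    ∃ e, ¬ r X (toggle L e X) := by
  by_contra! hall
  have key : ∀ g ∈ toggleGroup L, r X (g X) := by
    intro g hg
    induction hg using Subgroup.closure_induction with
    | mem g hg =>
      obtain ⟨e, rfl⟩ := hg
      exact hall e
    | one => exact r.refl X
    | mul a b ha _ iha ihb => exact r.trans iha (hr a ha _ _ ihb)
    | inv a ha iha => simpa using r.symm (hr _ (inv_mem ha) _ _ iha)
  have all : ∀ Y, r X Y := fun Y => by
    obtain ⟨g, hg, rfl⟩ := htrans X Y
    exact key g hg
  obtain ⟨Y, Z, h⟩ := hnontriv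
  exact h (r.trans (r.symm (all Y)) (all Z))

/-- An element of order dividing three that preserves every class and moves points in at most
one class is trivial. -/
theorem eq_one_of_pow_three_eq_one (hr : IsCongruence L r) (htrans : IsTransitive L)
    (hnontriv : ∃ X Y, ¬ r X Y) {g : Equiv.Perm {A : Finset E // A ∈ L}}
    (hg : g ∈ toggleGroup L) (hg3 : g ^ 3 = 1) (hgr : ∀ X, r X (g X))
    (hsupp : ∀ X Y, g X ≠ X → g Y ≠ Y → r X Y) : g = 1 := by
  by_contra hne
  obtain ⟨X, hX⟩ : ∃ X, g X ≠ X := by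
    by_contra! h
    exact hne (Equiv.ext h)
  obtain ⟨n, hn, m, hm, rfl⟩ := exists_eq_external_mul_internal hr htrans hg
  obtain ⟨e, he⟩ := exists_toggle_not_rel hr htrans hnontriv X
  have hext : ¬ IsInternal L r e := fun h => he (h.rel_toggle hr htrans X)
  have hfix : n (m (toggle L e X)) = toggle L e X := by
    by_contra h
    exact he (hsupp _ _ hX h)
  have hcomm : m (toggle L e X) = toggle L e (m X) :=
    (congrArg (· X) (commute_external_internal hr htrans
      (Subgroup.subset_closure ⟨e, hext, rfl⟩) hm).eq).symm
  have hmX : m X = X := by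
    refine Subtype.ext (Finset.ext fun f => ?_)
    by_cases hf : IsInternal L r f
    · have hfe : f ≠ e := fun h => hext (h ▸ hf)
      rw [← mem_toggle_iff hfe (m X), ← mem_toggle_iff hfe X, ← hcomm]
      conv_rhs => rw [← hfix]
      exact (mem_iff_of_mem_closure_toggle hn (fun h => h hf) _).symm
    · exact mem_iff_of_mem_closure_toggle hm hf X
  have hgX : (n * m) X = n X := by rw [Equiv.Perm.mul_apply, hmX]
  have hnn : n (n X) = X := by
    have h := external_symmDiff_eq hr hn (hgX ▸ hgr X)
    rw [symmDiff_comm] at h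
    exact Subtype.ext (symmDiff_left_injective _ h).symm
  have hmn : m (n X) = n X := by
    have := congrArg (· X) (commute_external_internal hr htrans hn hm).eq
    simpa [hmX] using this.symm
  have h3 : (n * m) ((n * m) ((n * m) X)) = X := congrArg (· X) hg3
  rw [hgX, Equiv.Perm.mul_apply n m (n X), hmn, hnn] at h3
  exact hX h3

end Congruence

section ThreeCycle

variable {α : Type*} [Fintype α] {r : Setoid α} {g : Equiv.Perm α}

/-- A three-cycle preserves each class of an invariant equivalence relation without singleton
classes. -/
theorem rel_apply_of_isThreeCycle [DecidableEq α] (hg : g.IsThreeCycle) (hr : ∀ x y, r x y → r (g x) (g y))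
    (hbig : ∀ x, ∃ y, y ≠ x ∧ r x y) (x : α) : r x (g x) := by
  by_contra hx
  have hmove : g x ≠ x := fun h => hx (h.symm ▸ r.refl x)
  obtain ⟨y, hyx, hxy⟩ := hbig x
  have hy : g y ≠ y := fun h => by
    have := hr _ _ hxy
    rw [h] at this
    exact hx (r.trans hxy (r.symm this))
  have hsupp := (hg.support_eq_iff_mem_support (a := x)).2 (Equiv.Perm.mem_support.2 hmove)
  have hmem := Equiv.Perm.mem_support.2 hy
  rw [hsupp] at hmem
  simp only [Finset.mem_insert, Finset.mem_singleton] at hmem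
  rcases hmem with rfl | rfl | rfl
  · exact hyx rfl
  · exact hx hxy
  · have h3 : g (g (g x)) = x := by
      have h := congrArg (· x) (pow_orderOf_eq_one g)
      rw [hg.orderOf] at h
      exact h
    have := hr _ _ hxy
    rw [h3] at this
    exact hx (r.symm this)

theorem rel_of_isCycle (hg : g.IsCycle) (hgr : ∀ x, r x (g x)) {x y : α}
    (hx : g x ≠ x) (hy : g y ≠ y) : r x y := by
  obtain ⟨i, rfl⟩ := hg.exists_pow_eq hx hy
  clear hy
  induction i with
  | zero => exact r.refl x
  | succ i ih =>
    rw [pow_succ', Equiv.Perm.mul_apply]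
    exact r.trans ih (hgr _)

end ThreeCycle

section Block

open scoped Pointwise

variable {G α : Type*} [Group G] [MulAction G α] [MulAction.IsPretransitive G α] {B : Set α}

/-- The equivalence relation whose classes are the translates of a block. -/
def blockSetoid (hB : MulAction.IsBlock G B) (hne : B.Nonempty) : Setoid α where
  r x y := ∃ g : G, g • x ∈ B ∧ g • y ∈ B
  iseqv :=
    { refl := fun x => by
        obtain ⟨b, hb⟩ := hne
        obtain ⟨g, hg⟩ := MulAction.exists_smul_eq G x b
        exact ⟨g, hg ▸ hb, hg ▸ hb⟩
      symm := fun ⟨g, hx, hy⟩ => ⟨g, hy, hx⟩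
      trans := by
        rintro x y z ⟨g, hx, hy⟩ ⟨h, hy', hz⟩
        have heq : g⁻¹ • B = h⁻¹ • B := by
          by_contra hne
          exact Set.disjoint_left.1 (hB hne) (Set.mem_inv_smul_set_iff.2 hy)
            (Set.mem_inv_smul_set_iff.2 hy')
        exact ⟨g, hx, Set.mem_inv_smul_set_iff.1 (heq ▸ Set.mem_inv_smul_set_iff.2 hz)⟩ }

theorem not_blockSetoid (hB : MulAction.IsBlock G B) {b c : α} (hb : b ∈ B) (hc : c ∉ B) :
    ¬ blockSetoid hB ⟨b, hb⟩ b c := by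
  rintro ⟨k, hkb, hkc⟩
  have heq : k • B = (1 : G) • B := by
    by_contra hne
    exact Set.disjoint_left.1 (hB hne) (Set.smul_mem_smul_set hb) (by simpa using hkb)
  rw [one_smul] at heq
  exact hc ((Set.smul_mem_smul_set_iff (a := k)).1 (heq.symm ▸ hkc))

end Block

/-- a transitive toggle group containing a 3-cycle contains the
alternating group on `L`. -/
theorem transitive_with_three_cycle_contains_alternating
    [Fintype E] (L : Finset (Finset E))
    (hnt : ∀ e : E, toggle L e ≠ 1)
    (htrans : IsTransitive L)
    (h3 : ∃ g ∈ toggleGroup L, Equiv.Perm.IsThreeCycle g) :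
    alternatingGroup {A : Finset E // A ∈ L} ≤ toggleGroup L := by
  have hpre : MulAction.IsPretransitive (toggleGroup L) {A : Finset E // A ∈ L} :=
    ⟨fun A B => let ⟨g, hg, h⟩ := htrans A B; ⟨⟨g, hg⟩, h⟩⟩
  obtain ⟨g, hg, hg3⟩ := h3
  refine Equiv.Perm.alternatingGroup_le_of_isPreprimitive_of_isThreeCycle_mem ⟨?_⟩ hg3 hg
  intro B hB
  by_contra hB'
  rw [MulAction.IsTrivialBlock, not_or, Set.not_subsingleton_iff] at hB'
  obtain ⟨hnt', huniv⟩ := hB'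
  let r := blockSetoid hB hnt'.nonempty
  have hr : IsCongruence L r := by
    rintro k hk X Y ⟨h, hX, hY⟩
    refine ⟨h * ⟨k, hk⟩⁻¹, ?_, ?_⟩ <;>
      simpa [mul_smul, Subgroup.smul_def] using ‹_›
  have hbig : ∀ X, ∃ Y, Y ≠ X ∧ r X Y := by
    intro X
    obtain ⟨b, hb, c, hc, hbc⟩ := hnt'
    obtain ⟨k, rfl⟩ := MulAction.exists_smul_eq (toggleGroup L) b X
    exact ⟨k • c, fun h => hbc (smul_left_cancel k h.symm), k⁻¹, by simpa using hb,
      by simpa using hc⟩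
  have hnontriv : ∃ X Y, ¬ r X Y := by
    obtain ⟨b, hb⟩ := hnt'.nonempty
    obtain ⟨c, hc⟩ := (Set.ne_univ_iff_exists_notMem B).1 huniv
    exact ⟨b, c, not_blockSetoid hB hb hc⟩
  have hgr := rel_apply_of_isThreeCycle hg3 (hr g hg) hbig
  have hone := eq_one_of_pow_three_eq_one hr htrans hnontriv hg
    (hg3.orderOf ▸ pow_orderOf_eq_one g) hgr (fun _ _ => rel_of_isCycle hg3.isCycle hgr)
  exact hg3.isCycle.ne_one hone

end TogglePaper
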